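/- Let A be a real Baer von Neumann regular poring, p ∈ Spec A, and B = ∏_{q ∈ Spec A} K_q an epof of A. Let e ∈ B be the idempotent whose component is 1 at every q ≠ p and 0 at p. Then p is an isolated point of Spec A if and only if there exists an ideal I of B with I ⊆ eB such that A → B → B/I is an essential extension of A. -/

import Mathlib

universe u

/-- A partial ordering (positive cone) of a commutative ring: closed under addition and
multiplication, contains all squares, and intersects its negative only in `0`. -/
def IsPartialOrdering {A : Type*} [CommRing A] (P : Set A) : Prop :=
  (∀ a ∈ P, ∀ b ∈ P, a + b ∈ P) ∧ (∀ a ∈ P, ∀ b ∈ P, a * b ∈ P) ∧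
  (∀ a : A, a ^ 2 ∈ P) ∧ (∀ a ∈ P, -a ∈ P → a = 0)

/-- A (formally) real ring: a sum of squares vanishes only if each term vanishes. -/
def IsRealRing (A : Type*) [CommRing A] : Prop :=
  ∀ (n : ℕ) (f : Fin n → A), (∑ i, f i ^ 2) = 0 → ∀ i, f i = 0

/-- A von Neumann regular commutative ring. -/
def IsVonNeumannRegular (A : Type*) [CommRing A] : Prop :=
  ∀ a : A, ∃ b : A, a = a ^ 2 * b

/-- A Baer ring: the annihilator of every subset is generated by an idempotent. -/
def IsBaerRing (A : Type*) [CommRing A] : Prop :=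
  ∀ S : Set A, ∃ e : A, e * e = e ∧ ∀ x : A, (∀ s ∈ S, x * s = 0) ↔ ∃ y : A, x = e * y

/-- An essential (ring) extension: an injective ring homomorphism such that every nonzero
ideal of the codomain meets the image of the domain nontrivially. -/
def IsEssentialExtension {A B : Type*} [CommRing A] [CommRing B] (f : A →+* B) : Prop :=
  Function.Injective f ∧ ∀ J : Ideal B, J ≠ ⊥ → ∃ a : A, f a ∈ J ∧ f a ≠ 0

/-- A real ring is real closed * if it admits no proper essential integral extension
which is again a real ring. -/
def IsRealClosedStar (B : Type u) [CommRing B] : Prop :=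
  IsRealRing B ∧ ∀ (C : Type u) [CommRing C] (f : B →+* C),
    IsRealRing C → IsEssentialExtension f → f.IsIntegral → Function.Surjective f

/-- `(B, Q)` together with the embedding `f` is a real closure * of the poring `(A, P)`:
`B` is a real closed * ring, an essential and integral extension of `A`, whose partial
ordering `Q` extends `P`. -/
structure IsRealClosureStarOf (A : Type u) [CommRing A] (P : Set A)
    (B : Type u) [CommRing B] (Q : Set B) (f : A →+* B) : Prop where
  pos_partial : IsPartialOrdering Q
  rcs : IsRealClosedStar B
  essential : IsEssentialExtension f
  integral : f.IsIntegral
  mono : ∀ a ∈ P, f a ∈ Q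

/-- Bundled real closure * of a poring `(A, P)`. -/
structure RealClosureStar (A : Type u) [CommRing A] (P : Set A) : Type (u + 1) where
  carrier : Type u
  [ring : CommRing carrier]
  pos : Set carrier
  emb : A →+* carrier
  is : IsRealClosureStarOf A P carrier pos emb

attribute [instance] RealClosureStar.ring

/-- Two real closures * of `(A, P)` are `A`-isomorphic: there is a ring isomorphism over
`A` preserving the partial orderings in both directions. -/
def RealClosureStar.AIso {A : Type u} [CommRing A] {P : Set A}
    (B C : RealClosureStar A P) : Prop :=
  ∃ e : B.carrier ≃+* C.carrier, (∀ a : A, e (B.emb a) = C.emb a) ∧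
    ∀ b : B.carrier, b ∈ B.pos ↔ e b ∈ C.pos

/-- A poring `(A, P)` has a unique real closure *: one exists, and any two are
`A`-isomorphic as porings. -/
def HasUniqueRealClosureStar (A : Type u) [CommRing A] (P : Set A) : Prop :=
  Nonempty (RealClosureStar A P) ∧ ∀ B C : RealClosureStar A P, B.AIso C

/-- A prime cone of a commutative ring. -/
structure PrimeCone (A : Type u) [CommRing A] : Type u where
  carrier : Set A
  add_mem : ∀ a ∈ carrier, ∀ b ∈ carrier, a + b ∈ carrier
  mul_mem : ∀ a ∈ carrier, ∀ b ∈ carrier, a * b ∈ carrier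
  sq_mem : ∀ a : A, a ^ 2 ∈ carrier
  mem_or_neg_mem : ∀ a : A, a ∈ carrier ∨ -a ∈ carrier
  support : Ideal A
  mem_support : ∀ a : A, a ∈ support ↔ a ∈ carrier ∧ -a ∈ carrier
  support_isPrime : support.IsPrime

/-- The real spectrum of a poring `(A, P)`: the prime cones containing `P`. -/
def RealSpectrum (A : Type u) [CommRing A] (P : Set A) : Type u :=
  {α : PrimeCone A // P ⊆ α.carrier}

/-- A real closed field: formally real, every element or its negative is a square, and
every polynomial of odd degree has a root. -/
def IsRealClosedField (F : Type u) [Field F] : Prop :=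
  IsRealRing F ∧ (∀ x : F, (∃ y : F, y ^ 2 = x) ∨ ∃ y : F, y ^ 2 = -x) ∧
    ∀ p : Polynomial F, Odd p.natDegree → ∃ x : F, Polynomial.eval x p = 0

/-- A total ordering (positive cone) of a ring. -/
def IsTotalOrderingCone {K : Type*} [CommRing K] (T : Set K) : Prop :=
  (∀ a ∈ T, ∀ b ∈ T, a + b ∈ T) ∧ (∀ a ∈ T, ∀ b ∈ T, a * b ∈ T) ∧
  (∀ x : K, x ∈ T ∨ -x ∈ T) ∧ ∀ x ∈ T, -x ∈ T → x = 0

/-- The data `(K, κ)` is an epof (extension of product of fields) of the poring `(A, P)`: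
for each prime `p` of `A`, `K p` is a real closed field, algebraic over `Frac (A / p)`
(i.e. every element is algebraic over the image of `A` under `κ p`, whose kernel is `p`),
whose unique ordering (the squares) extends the image of `P` in `A / p`.  The epof itself
is the product `∀ p, K p` with the embedding `Pi.ringHom κ` and partial ordering the
squares. -/
structure IsEpof (A : Type u) [CommRing A] (P : Set A)
    (K : PrimeSpectrum A → Type u) [∀ p, Field (K p)] (κ : ∀ p, A →+* K p) : Prop where
  ker : ∀ (p : PrimeSpectrum A) (a : A), κ p a = 0 ↔ a ∈ p.asIdeal
  rcf : ∀ p, IsRealClosedField (K p)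
  alg : ∀ (p) (x : K p), ∃ q : Polynomial A,
    Polynomial.eval₂ (κ p) x q = 0 ∧ q.map (κ p) ≠ 0
  ordext : ∀ p, ∀ a ∈ P, ∃ y : K p, y ^ 2 = κ p a

open scoped Classical

theorem IsVonNeumannRegular.isReduced {A : Type*} [CommRing A] (h : IsVonNeumannRegular A) :
    IsReduced A := by
  refine (isReduced_iff_pow_one_lt 2 one_lt_two).2 fun a ha => ?_
  obtain ⟨b, hb⟩ := h a
  rw [hb, ha, zero_mul]

theorem IsVonNeumannRegular.eq_of_le {A : Type*} [CommRing A] (h : IsVonNeumannRegular A)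
    {p q : PrimeSpectrum A} (hpq : p.asIdeal ≤ q.asIdeal) : p = q := by
  refine PrimeSpectrum.ext (le_antisymm hpq fun a ha => ?_)
  obtain ⟨b, hb⟩ := h a
  have hz : a * (1 - a * b) ∈ p.asIdeal := by
    have : a * (1 - a * b) = 0 := by linear_combination hb
    simp [this]
  refine (p.isPrime.mem_or_mem hz).resolve_right fun hmem => q.isPrime.ne_top ?_
  rw [Ideal.eq_top_iff_one]
  simpa using q.asIdeal.add_mem (hpq hmem) (q.asIdeal.mul_mem_right b ha)

/-- An ideal maximal among those contracting to zero yields an essential extension. -/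
theorem exists_comap_eq_bot_and_isEssentialExtension {A B : Type*} [CommRing A] [CommRing B]
    (f : A →+* B) (hf : Function.Injective f) :
    ∃ I : Ideal B, I.comap f = ⊥ ∧ IsEssentialExtension ((Ideal.Quotient.mk I).comp f) := by
  obtain ⟨I, -, hI⟩ := zorn_le_nonempty₀ {I : Ideal B | I.comap f = ⊥} (fun c hc hchain J hJ => by
    refine ⟨sSup c, ?_, fun K hK => le_sSup hK⟩
    refine (Submodule.eq_bot_iff _).2 fun a ha => ?_
    obtain ⟨K, hK, haK⟩ :=
      (Submodule.mem_sSup_of_directed ⟨J, hJ⟩ hchain.directedOn).1 (Ideal.mem_comap.1 ha)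
    exact (Submodule.eq_bot_iff _).1 (hc hK) a haK) ⊥
    ((Submodule.eq_bot_iff _).2 fun a ha => hf (by simpa using ha))
  have hIbot : I.comap f = ⊥ := hI.prop
  refine ⟨I, hIbot, ?_, fun J hJ => ?_⟩
  · refine (injective_iff_map_eq_zero _).2 fun a ha => ?_
    exact (Submodule.eq_bot_iff _).1 hIbot a
      (Ideal.mem_comap.2 (Ideal.Quotient.eq_zero_iff_mem.1 ha))
  · by_contra! hcon
    refine hJ ((Submodule.eq_bot_iff _).2 fun y hy => ?_)
    obtain ⟨x, rfl⟩ := Ideal.Quotient.mk_surjective y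
    have hle : I ≤ J.comap (Ideal.Quotient.mk I) := fun z hz => by
      simp [Ideal.Quotient.eq_zero_iff_mem.2 hz]
    have hbot : (J.comap (Ideal.Quotient.mk I)).comap f = ⊥ :=
      (Submodule.eq_bot_iff _).2 fun a ha =>
        (Submodule.eq_bot_iff _).1 hIbot a
          (Ideal.mem_comap.2 (Ideal.Quotient.eq_zero_iff_mem.1 (hcon a ha)))
    exact Ideal.Quotient.eq_zero_iff_mem.2 (hI.le_of_ge hbot hle hy)

theorem IsEpof.injective {A : Type u} [CommRing A] [IsReduced A] {P : Set A}
    {K : PrimeSpectrum A → Type u} [∀ q, Field (K q)] {κ : ∀ q, A →+* K q}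
    (h : IsEpof A P K κ) : Function.Injective (Pi.ringHom κ) := by
  refine (injective_iff_map_eq_zero _).2 fun a ha => ?_
  have : a ∈ nilradical A := nilpotent_iff_mem_prime.2 fun J hJ =>
    (h.ker ⟨J, hJ⟩ a).1 (congrFun ha ⟨J, hJ⟩)
  exact IsNilpotent.eq_zero this

theorem mem_span_ite_iff {ι : Type*} {K : ι → Type*} [∀ q, Field (K q)] (p : ι) (x : ∀ q, K q) :
    x ∈ Ideal.span {fun q => if q = p then (0 : K q) else 1} ↔ x p = 0 := by
  rw [Ideal.mem_span_singleton']
  constructor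
  · rintro ⟨y, rfl⟩
    simp
  · intro hx
    refine ⟨x, funext fun q => ?_⟩
    by_cases hq : q = p
    · subst hq
      simp [hx]
    · simp [hq]

/-- Let `(A, P)` be a real Baer von Neumann regular poring,
`p ∈ Spec A`, and `B = ∏_{q ∈ Spec A} K q` an epof of `A`.  Let `e ∈ B` be the idempotent
with component `1` at every `q ≠ p` and `0` at `p`.  Then `p` is an isolated point of
`Spec A` iff there is an ideal `I ⊆ eB` of `B` such that `A → B → B / I` is an essential
extension of `A`. -/
theorem isolated_iff_exists_essential_ideal_le
    (A : Type u) [CommRing A] (P : Set A) (hP : IsPartialOrdering P)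
    (hreal : IsRealRing A) (hBaer : IsBaerRing A) (hvnr : IsVonNeumannRegular A)
    (p : PrimeSpectrum A)
    (K : PrimeSpectrum A → Type u) [∀ q, Field (K q)] (κ : ∀ q, A →+* K q)
    (hepof : IsEpof A P K κ) :
    IsOpen ({p} : Set (PrimeSpectrum A)) ↔
      ∃ I : Ideal (∀ q, K q),
        I ≤ Ideal.span {fun q => if q = p then (0 : K q) else 1} ∧
        IsEssentialExtension ((Ideal.Quotient.mk I).comp (Pi.ringHom κ)) := by
  have := hvnr.isReduced
  have happ : ∀ a q, Pi.ringHom κ a q = κ q a := fun _ _ => rfl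
  constructor
  · intro hopen
    obtain ⟨I, hI, hess⟩ := exists_comap_eq_bot_and_isEssentialExtension _ hepof.injective
    refine ⟨I, fun x hx => ?_, hess⟩
    rw [mem_span_ite_iff]
    by_contra hxp
    obtain ⟨_, ⟨f, rfl⟩, hpf, hf⟩ :=
      PrimeSpectrum.isTopologicalBasis_basic_opens.exists_subset_of_mem_open
        (Set.mem_singleton p) hopen
    have hpf : f ∉ p.asIdeal := hpf
    have hfI : Pi.ringHom κ f ∈ I := by
      have heq : Pi.ringHom κ f = Pi.single p (κ p f / x p) * x := by
        funext q
        by_cases hq : q = p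
        · subst hq
          simp [happ, hxp]
        · have hfq : κ q f = 0 := (hepof.ker q f).2 (by
            by_contra hfq
            exact hq (hf hfq))
          simp [happ, hq, hfq]
      rw [heq]
      exact I.mul_mem_left _ hx
    have hf0 : f = 0 := (Submodule.eq_bot_iff _).1 hI f hfI
    exact hpf (hf0 ▸ p.asIdeal.zero_mem)
  · rintro ⟨I, hI, hinj, hess⟩
    have hIp : ∀ x ∈ I, x p = 0 := fun x hx => (mem_span_ite_iff p x).1 (hI hx)
    set c : ∀ q, K q := Pi.single p 1 with hc
    have hcI : c ∉ I := fun h => by simpa [hc] using hIp c h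
    obtain ⟨a, ha, ha0⟩ := hess (Ideal.span {Ideal.Quotient.mk I c}) (by
      simpa [Ideal.span_singleton_eq_bot, Ideal.Quotient.eq_zero_iff_mem] using hcI)
    obtain ⟨y, hy⟩ := Ideal.mem_span_singleton'.1 ha
    have hann : ∀ g ∈ p.asIdeal, a * g = 0 := fun g hg => by
      apply hinj
      have hcg : c * Pi.ringHom κ g = 0 := by
        funext q
        by_cases hq : q = p
        · subst hq
          simp [happ, (hepof.ker q g).2 hg]
        · simp [hc, hq]
      rw [map_mul, ← hy, RingHom.comp_apply, mul_assoc, ← map_mul, hcg]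
      simp
    have ha_ne : a ≠ 0 := fun h => ha0 (by simp [h])
    have hap : a ∉ p.asIdeal := fun h => ha_ne (IsReduced.eq_zero a ⟨2, by rw [sq, hann a h]⟩)
    have heq : ({p} : Set (PrimeSpectrum A)) = PrimeSpectrum.basicOpen a := by
      ext q
      constructor
      · rintro rfl
        exact hap
      · intro hq
        refine (hvnr.eq_of_le fun g hg => ?_).symm
        exact (q.isPrime.mem_or_mem (hann g hg ▸ q.asIdeal.zero_mem)).resolve_left hq
    rw [heq]
    exact (PrimeSpectrum.basicOpen a).isOpen
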